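/- arXiv:2511.05788 — 3 statements merged into one kernel-verified Lean document; each statement's English description precedes it below -/
import Mathlib

section
/- Consider the HAR method run on F = f + ψ. Then the unsuccessful index set U = {k ≥ 1 : (α+1)M_k < 2H_k} is finite, and its cardinality satisfies |U| ≤ Ū := ⌈log_{(α+1)/2}(H_max/H_0)⌉, where H_max = max{H_0, L_p}. -/
open scoped BigOperators RealInnerProductSpace

noncomputable section

/-- The `p`-th order Taylor polynomial `T_p(y; x)` of `f` at `x`, evaluated at `y`. -/
def taylorPoly {n : ℕ} (p : ℕ) (f : EuclideanSpace ℝ (Fin n) → ℝ)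
    (x y : EuclideanSpace ℝ (Fin n)) : ℝ :=
  f x + ∑ ℓ ∈ Finset.Icc 1 p,
    (1 / (Nat.factorial ℓ : ℝ)) * iteratedFDeriv ℝ ℓ f x (fun _ => y - x)

/-- The regularized Taylor polynomial `Ω_p^σ(y; x)`. -/
def omegaReg {n : ℕ} (p : ℕ) (σ : ℝ) (f : EuclideanSpace ℝ (Fin n) → ℝ)
    (x y : EuclideanSpace ℝ (Fin n)) : ℝ :=
  taylorPoly p f x y + σ / (Nat.factorial (p + 1) : ℝ) * ‖y - x‖ ^ (p + 1)

/-- `H_max = max {H₀, L_p}`. -/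
def Hmax (H0 Lp : ℝ) : ℝ := max H0 Lp

/-- `Ū = ⌈log_{(α+1)/2} (H_max / H₀)⌉`. -/
def Ubar (α H0 Lp : ℝ) : ℤ := ⌈Real.logb ((α + 1) / 2) (Hmax H0 Lp / H0)⌉

/-- One-sided Taylor estimate: if `G (l + 1)` is the derivative of `G l` for `l < p` and
`G p t - G p 0 ≤ C * t`, then the remainder of order `p` of `G 0` is at most
`C * t ^ (p + 1) / (p + 1)!`. -/
theorem le_taylor_sum_of_hasDerivAt {C : ℝ} (p : ℕ) (G : ℕ → ℝ → ℝ)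
    (hG : ∀ l < p, ∀ t, HasDerivAt (G l) (G (l + 1) t) t)
    (hC : ∀ t, 0 ≤ t → G p t - G p 0 ≤ C * t) (t : ℝ) (ht : 0 ≤ t) :
    G 0 t ≤ ∑ l ∈ Finset.range (p + 1), G l 0 * (t ^ l / (l.factorial : ℝ))
      + C * (t ^ (p + 1) / ((p + 1).factorial : ℝ)) := by
  induction p generalizing G t with
  | zero =>
    have := hC t ht
    simp only [zero_add, Finset.sum_range_one, pow_zero, pow_one, Nat.factorial_zero,
      Nat.factorial_one, Nat.cast_one, div_one, mul_one]
    linarith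
  | succ p ih =>
    have hpow (l : ℕ) (s : ℝ) : HasDerivAt
        (fun u : ℝ => u ^ (l + 1) / ((l + 1).factorial : ℝ)) (s ^ l / (l.factorial : ℝ)) s := by
      refine ((hasDerivAt_pow (l + 1) s).div_const _).congr_deriv ?_
      have : (l.factorial : ℝ) ≠ 0 := by positivity
      rw [Nat.factorial_succ]
      push_cast
      field_simp
    let R : ℝ → ℝ := fun u => ∑ l ∈ Finset.range (p + 1),
      G (l + 1) 0 * (u ^ (l + 1) / ((l + 1).factorial : ℝ))
        + C * (u ^ (p + 1 + 1) / ((p + 1 + 1).factorial : ℝ)) - G 0 u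
    have hR (s : ℝ) : HasDerivAt R (∑ l ∈ Finset.range (p + 1),
        G (l + 1) 0 * (s ^ l / (l.factorial : ℝ))
          + C * (s ^ (p + 1) / ((p + 1).factorial : ℝ)) - G 1 s) s :=
      ((HasDerivAt.fun_sum fun l _ => (hpow l s).const_mul (G (l + 1) 0)).add
        ((hpow (p + 1) s).const_mul C)).sub (hG 0 p.succ_pos s)
    have hmono : MonotoneOn R (Set.Ici 0) := by
      refine monotoneOn_of_deriv_nonneg (convex_Ici 0)
        (fun s _ => (hR s).continuousAt.continuousWithinAt)
        (fun s _ => (hR s).differentiableAt.differentiableWithinAt) fun s hs => ?_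
      rw [(hR s).deriv, sub_nonneg]
      exact ih (fun l => G (l + 1)) (fun l hl => hG (l + 1) (by lia)) hC s (interior_subset hs)
    have h := hmono Set.self_mem_Ici ht ht
    simp only [R, ne_eq, Nat.add_eq_zero_iff, one_ne_zero, and_false, not_false_eq_true,
      zero_pow, zero_div, mul_zero, Finset.sum_const_zero, add_zero, zero_sub] at h
    rw [Finset.sum_range_succ']
    simp only [pow_zero, Nat.factorial_zero, Nat.cast_one, div_one, mul_one]
    linarith

theorem hasDerivAt_iteratedFDeriv_line {E : Type*} [NormedAddCommGroup E] [NormedSpace ℝ E]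
    {p : ℕ} {f : E → ℝ} (hf : ContDiff ℝ p f) {l : ℕ} (hl : l < p) (x d : E) (t : ℝ) :
    HasDerivAt (fun s : ℝ => iteratedFDeriv ℝ l f (x + s • d) fun _ => d)
      (iteratedFDeriv ℝ (l + 1) f (x + t • d) fun _ => d) t := by
  have hline : HasDerivAt (fun s : ℝ => x + s • d) d t := by
    simpa using ((hasDerivAt_id t).smul_const d).const_add x
  have hdiff : HasFDerivAt (iteratedFDeriv ℝ l f) (fderiv ℝ (iteratedFDeriv ℝ l f) (x + t • d))
      (x + t • d) :=
    (hf.differentiable_iteratedFDeriv (by exact_mod_cast hl) _).hasFDerivAt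
  have happly := (ContinuousMultilinearMap.apply ℝ (fun _ : Fin l => E) ℝ
    (fun _ => d)).hasFDerivAt.comp_hasDerivAt t (hdiff.comp_hasDerivAt t hline)
  exact happly

/-- Upper Taylor bound for a function whose `p`-th derivative is `Lp`-Lipschitz. -/
theorem sub_taylorPoly_le {n p : ℕ} {f : EuclideanSpace ℝ (Fin n) → ℝ} {Lp : ℝ}
    (hf : ContDiff ℝ p f)
    (hLip : ∀ x y : EuclideanSpace ℝ (Fin n),
      ‖iteratedFDeriv ℝ p f x - iteratedFDeriv ℝ p f y‖ ≤ Lp * ‖x - y‖)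
    (x d : EuclideanSpace ℝ (Fin n)) :
    f (x + d) - taylorPoly p f x (x + d)
      ≤ Lp * ‖d‖ ^ (p + 1) / (Nat.factorial (p + 1) : ℝ) := by
  have h := le_taylor_sum_of_hasDerivAt (C := Lp * ‖d‖ ^ (p + 1)) p
    (fun l t => iteratedFDeriv ℝ l f (x + t • d) fun _ => d)
    (fun l hl t => hasDerivAt_iteratedFDeriv_line hf hl x d t) (fun t ht => ?_) 1 zero_le_one
  · simp only [one_smul, iteratedFDeriv_zero_apply, zero_smul, add_zero, one_pow] at h
    have hT : taylorPoly p f x (x + d) = ∑ l ∈ Finset.range (p + 1),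
        (iteratedFDeriv ℝ l f x fun _ => d) * (1 / (l.factorial : ℝ)) := by
      rw [taylorPoly, Finset.range_eq_Ico, Finset.sum_eq_sum_Ico_succ_bot p.succ_pos]
      simp [Finset.Ico_add_one_right_eq_Icc, mul_comm]
    rw [hT, mul_div_assoc, ← mul_one_div (‖d‖ ^ (p + 1))]
    linarith
  · calc (iteratedFDeriv ℝ p f (x + t • d) fun _ => d)
          - (iteratedFDeriv ℝ p f (x + (0 : ℝ) • d) fun _ => d)
        ≤ ‖(iteratedFDeriv ℝ p f (x + t • d) - iteratedFDeriv ℝ p f (x + (0 : ℝ) • d))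
            fun _ => d‖ := Real.le_norm_self _
      _ ≤ ‖iteratedFDeriv ℝ p f (x + t • d) - iteratedFDeriv ℝ p f (x + (0 : ℝ) • d)‖
            * ‖d‖ ^ p := by
          simpa using ContinuousMultilinearMap.le_opNorm (iteratedFDeriv ℝ p f (x + t • d)
            - iteratedFDeriv ℝ p f (x + (0 : ℝ) • d)) fun _ => d
      _ ≤ Lp * (t * ‖d‖) * ‖d‖ ^ p := by
          gcongr
          simpa [norm_smul, abs_of_nonneg ht] using hLip (x + t • d) (x + (0 : ℝ) • d)
      _ = Lp * ‖d‖ ^ (p + 1) * t := by ring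

/-- If `M` is the sequence of running maxima of a sequence `H` bounded above by `B`, then the
indices `k` with `q * M k < H k` number at most `⌈log_q (B / H 0)⌉`. -/
theorem finite_and_ncard_le_of_running_max {H M : ℕ → ℝ} {q B : ℝ} (hq : 1 < q) (hH0 : 0 < H 0)
    (hM0 : M 0 = H 0) (hM : ∀ k, M (k + 1) = max (M k) (H k)) (hB : ∀ k, H k ≤ B) :
    {k : ℕ | 1 ≤ k ∧ q * M k < H k}.Finite ∧
      ({k : ℕ | 1 ≤ k ∧ q * M k < H k}.ncard : ℤ) ≤ ⌈Real.logb q (B / H 0)⌉ := by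
  classical
  have hMB (k : ℕ) : M k ≤ B := by
    induction k with
    | zero => exact hM0 ▸ hB 0
    | succ k ih => exact hM k ▸ max_le ih (hB k)
  have hgrow (m : ℕ) :
      q ^ ((Finset.Icc 1 m).filter fun k => q * M k < H k).card * H 0 ≤ M (m + 1) := by
    induction m with
    | zero => simp [hM, hM0]
    | succ m ih =>
      rw [← Finset.insert_Icc_right_eq_Icc_add_one (by lia), Finset.filter_insert]
      split_ifs with h
      · rw [Finset.card_insert_of_notMem (by simp), pow_succ']
        calc _ = q * (q ^ ((Finset.Icc 1 m).filter fun k => q * M k < H k).card * H 0) := by ring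
          _ ≤ q * M (m + 1) := by gcongr
          _ ≤ H (m + 1) := h.le
          _ ≤ M (m + 1 + 1) := hM (m + 1) ▸ le_max_right _ _
      · exact ih.trans (hM (m + 1) ▸ le_max_left _ _)
  have hcard (s : Finset ℕ) (hs : (s : Set ℕ) ⊆ {k : ℕ | 1 ≤ k ∧ q * M k < H k}) :
      (s.card : ℝ) ≤ Real.logb q (B / H 0) := by
    have hBpos : 0 < B := hH0.trans_le (hB 0)
    rw [Real.le_logb_iff_rpow_le hq (by positivity), Real.rpow_natCast, le_div_iff₀ hH0]
    refine le_trans ?_ ((hgrow (s.sup id)).trans (hMB _))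
    gcongr
    · exact hq.le
    · intro k hk
      simpa [(hs hk).1, (hs hk).2] using Finset.le_sup (f := id) hk
  have hfin : {k : ℕ | 1 ≤ k ∧ q * M k < H k}.Finite := by
    by_contra hinf
    obtain ⟨s, hs, hsc⟩ := Set.Infinite.exists_subset_card_eq hinf
      (⌊Real.logb q (B / H 0)⌋₊ + 1)
    have h := Nat.le_floor (hcard s hs)
    lia
  refine ⟨hfin, ?_⟩
  rw [Set.ncard_eq_toFinset_card _ hfin]
  have h := (hcard hfin.toFinset (by simp)).trans (Int.le_ceil _)
  exact_mod_cast h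

theorem HAR_unsuccessful_finite
    {n : ℕ} (p : ℕ) (hp : 1 ≤ p)
    (f : EuclideanSpace ℝ (Fin n) → ℝ) (Lp : ℝ)
    (hf : ContDiff ℝ p f)
    (hLip : ∀ x y : EuclideanSpace ℝ (Fin n),
      ‖iteratedFDeriv ℝ p f x - iteratedFDeriv ℝ p f y‖ ≤ Lp * ‖x - y‖)
    (domψ : Set (EuclideanSpace ℝ (Fin n))) (ψ : EuclideanSpace ℝ (Fin n) → ℝ)
    (hdom_ne : domψ.Nonempty) (hdom_closed : IsClosed domψ) (hdom_conv : Convex ℝ domψ)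
    (hψconv : ConvexOn ℝ domψ ψ) (hψlsc : LowerSemicontinuousOn ψ domψ)
    (xstar : EuclideanSpace ℝ (Fin n)) (hstar : xstar ∈ domψ)
    (hminF : ∀ z ∈ domψ, f xstar + ψ xstar ≤ f z + ψ z)
    (α : ℝ) (hα : 1 < α)
    (x d : ℕ → EuclideanSpace ℝ (Fin n)) (H M : ℕ → ℝ)
    (hx0 : x 0 ∈ domψ) (hH0 : 0 < H 0) (hM0 : M 0 = H 0)
    (hM : ∀ k, 1 ≤ k → M k = max (M (k - 1)) (H (k - 1)))
    (hdmem : ∀ k, 1 ≤ k → x (k - 1) + d k ∈ domψ)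
    (hdmin : ∀ k, 1 ≤ k → ∀ z ∈ domψ,
      omegaReg p (α * M k) f (x (k - 1)) (x (k - 1) + d k) + ψ (x (k - 1) + d k)
        ≤ omegaReg p (α * M k) f (x (k - 1)) z + ψ z)
    (hdne : ∀ k, 1 ≤ k → d k ≠ 0)
    (hxk : ∀ k, 1 ≤ k →
      x k = if f (x (k - 1) + d k) + ψ (x (k - 1) + d k) ≤ f (x (k - 1)) + ψ (x (k - 1))
            then x (k - 1) + d k else x (k - 1))
    (hHk : ∀ k, 1 ≤ k → H k / (Nat.factorial (p + 1) : ℝ)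
      = (f (x (k - 1) + d k) - taylorPoly p f (x (k - 1)) (x (k - 1) + d k)) / ‖d k‖ ^ (p + 1)) :
    {k : ℕ | 1 ≤ k ∧ (α + 1) * M k < 2 * H k}.Finite ∧
    ({k : ℕ | 1 ≤ k ∧ (α + 1) * M k < 2 * H k}.ncard : ℤ) ≤ Ubar α (H 0) Lp := by
  have hset : {k : ℕ | 1 ≤ k ∧ (α + 1) * M k < 2 * H k}
      = {k : ℕ | 1 ≤ k ∧ (α + 1) / 2 * M k < H k} := by
    ext k
    simp only [Set.mem_ofPred_eq]
    refine and_congr_right fun _ => ⟨fun h => ?_, fun h => ?_⟩ <;> linarith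
  rw [hset]
  refine finite_and_ncard_le_of_running_max (by linarith) hH0 hM0
    (fun k => hM (k + 1) (by lia)) fun k => ?_
  rcases Nat.eq_zero_or_pos k with rfl | hk
  · exact le_max_left _ _
  · refine le_trans ?_ (le_max_right _ _)
    have hd : 0 < ‖d k‖ ^ (p + 1) := pow_pos (norm_pos_iff.2 (hdne k hk)) _
    have hfac : (0 : ℝ) < (Nat.factorial (p + 1) : ℝ) := by positivity
    rw [← div_le_div_iff_of_pos_right hfac, hHk k hk, div_le_iff₀ hd, div_mul_eq_mul_div]
    exact sub_taylorPoly_le hf hLip (x (k - 1)) (d k)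
end
end

section
/- Suppose in addition that f is convex and that the initial sublevel set {x ∈ dom ψ : F(x) ≤ F(x^0)} has diameter at most R < ∞. Then the sequence generated by the HAR method satisfies, for every integer k > Ū, F(x^k) − F(x⋆) ≤ (2 α H_max R^{p+1} / p!) · ((p+1)/(k − Ū))^p, where H_max = max{H_0, L_p} and Ū = ⌈log_{(α+1)/2}(H_max/H_0)⌉. -/
open scoped BigOperators RealInnerProductSpace

noncomputable section

/-- Taylor's theorem with a Lipschitz top derivative: the remainder is at most
`L / (p + 1)! * ‖h‖ ^ (p + 1)` in absolute value. -/
theorem abs_sub_taylorPoly_le {n p : ℕ} (hp : 1 ≤ p) {f : EuclideanSpace ℝ (Fin n) → ℝ} {L : ℝ}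
    (hf : ContDiff ℝ p f)
    (hLip : ∀ x y : EuclideanSpace ℝ (Fin n),
      ‖iteratedFDeriv ℝ p f x - iteratedFDeriv ℝ p f y‖ ≤ L * ‖x - y‖)
    (x h : EuclideanSpace ℝ (Fin n)) :
    |f (x + h) - taylorPoly p f x (x + h)| ≤ L / (Nat.factorial (p + 1) : ℝ) * ‖h‖ ^ (p + 1) := by
  obtain ⟨m, rfl⟩ : ∃ m, p = m + 1 := ⟨p - 1, by omega⟩
  have hcont : Continuous fun t : ℝ => iteratedFDeriv ℝ (m + 1) f (x + t • h) (fun _ => h) := by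
    have h1 : Continuous (iteratedFDeriv ℝ (m + 1) f) := hf.continuous_iteratedFDeriv (by simp)
    have h2 : Continuous fun t : ℝ => iteratedFDeriv ℝ (m + 1) f (x + t • h) :=
      h1.comp (by fun_prop)
    exact h2.eval_const _
  have htaylor := map_add_eq_sum_add_integral_iteratedFDeriv (n := m) (f := f) (x := x) (y := h)
    fun t _ => by exact_mod_cast hf.contDiffAt
  have hpow : ∫ t in (0 : ℝ)..1, (1 - t) ^ m = 1 / ((m : ℝ) + 1) := by
    rw [intervalIntegral.integral_comp_sub_left (fun t : ℝ => t ^ m) 1]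
    simp
  have hpow' : ∫ t in (0 : ℝ)..1, (1 - t) ^ (m + 1) = 1 / ((m : ℝ) + 2) := by
    rw [intervalIntegral.integral_comp_sub_left (fun t : ℝ => t ^ (m + 1)) 1]
    simp; ring
  have hpoly : taylorPoly (m + 1) f x (x + h)
      = ∑ k ∈ Finset.range (m + 1),
          (Nat.factorial k : ℝ)⁻¹ • iteratedFDeriv ℝ k f x (fun _ => h)
        + (Nat.factorial (m + 1) : ℝ)⁻¹ * iteratedFDeriv ℝ (m + 1) f x (fun _ => h) := by
    have h1 := Finset.sum_range_succ (fun k =>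
      (Nat.factorial k : ℝ)⁻¹ • iteratedFDeriv ℝ k f x (fun _ => h)) (m + 1)
    rw [smul_eq_mul] at h1
    rw [← h1, Finset.sum_range_succ', taylorPoly,
      ← Finset.Ico_add_one_right_eq_Icc, Finset.sum_Ico_eq_sum_range]
    simp only [add_comm (f x), Nat.add_sub_cancel, one_div, smul_eq_mul, Nat.factorial_zero,
      Nat.cast_one, inv_one, one_mul, iteratedFDeriv_zero_apply, add_sub_cancel_left, add_left_inj]
    exact Finset.sum_congr rfl fun k _ => by rw [Nat.add_comm 1 k]
  have hrem : f (x + h) - taylorPoly (m + 1) f x (x + h)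
      = (Nat.factorial m : ℝ)⁻¹ * ∫ t in (0 : ℝ)..1, (1 - t) ^ m *
          (iteratedFDeriv ℝ (m + 1) f (x + t • h) (fun _ => h)
            - iteratedFDeriv ℝ (m + 1) f x (fun _ => h)) := by
    simp_rw [mul_sub]
    rw [intervalIntegral.integral_sub (Continuous.intervalIntegrable (by fun_prop) _ _)
      (Continuous.intervalIntegrable (by fun_prop) _ _),
      intervalIntegral.integral_mul_const, hpow, htaylor, hpoly, Nat.factorial_succ]
    simp only [smul_eq_mul]
    push_cast
    field_simp
    ring
  have hbound : ‖∫ t in (0 : ℝ)..1, (1 - t) ^ m *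
          (iteratedFDeriv ℝ (m + 1) f (x + t • h) (fun _ => h)
            - iteratedFDeriv ℝ (m + 1) f x (fun _ => h))‖
      ≤ ∫ t in (0 : ℝ)..1, ((1 - t) ^ m - (1 - t) ^ (m + 1)) * (L * ‖h‖ ^ (m + 2)) := by
    refine intervalIntegral.norm_integral_le_of_norm_le zero_le_one
      (Filter.Eventually.of_forall fun t ht => ?_)
      (Continuous.intervalIntegrable (by fun_prop) _ _)
    have ht0 : 0 ≤ t := ht.1.le
    have ht1 : 0 ≤ 1 - t := sub_nonneg.2 ht.2
    have h1 := (iteratedFDeriv ℝ (m + 1) f (x + t • h)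
      - iteratedFDeriv ℝ (m + 1) f x).le_opNorm (fun _ => h)
    have h2 := hLip (x + t • h) x
    rw [add_sub_cancel_left, norm_smul, Real.norm_of_nonneg ht0] at h2
    simp only [Finset.prod_const, Finset.card_univ, Fintype.card_fin] at h1
    rw [norm_mul, Real.norm_of_nonneg (pow_nonneg ht1 m)]
    calc _ ≤ (1 - t) ^ m * (L * (t * ‖h‖) * ‖h‖ ^ (m + 1)) := by
            refine mul_le_mul_of_nonneg_left ?_ (pow_nonneg ht1 m)
            exact h1.trans (mul_le_mul_of_nonneg_right h2 (by positivity))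
      _ = _ := by ring
  rw [intervalIntegral.integral_mul_const, intervalIntegral.integral_sub
    (Continuous.intervalIntegrable (by fun_prop) _ _)
    (Continuous.intervalIntegrable (by fun_prop) _ _), hpow, hpow'] at hbound
  rw [hrem, abs_mul, abs_of_pos (by positivity)]
  refine (mul_le_mul_of_nonneg_left hbound (by positivity)).trans_eq ?_
  rw [Nat.factorial_succ, Nat.factorial_succ]
  push_cast
  field_simp
  ring

theorem succ_pow_sub_pow_le (p : ℕ) {s : ℝ} (hs : 0 ≤ s) :
    (s + 1) ^ (p + 1) - s ^ (p + 1) ≤ (p + 1) * (s + 1) ^ p := by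
  induction p with
  | zero => simp
  | succ p ih =>
    have h1 : s ^ (p + 1) ≤ (s + 1) ^ (p + 1) := by gcongr; linarith
    have h2 := mul_le_mul_of_nonneg_left ih (by linarith : 0 ≤ s + 1)
    push_cast
    calc (s + 1) ^ (p + 1 + 1) - s ^ (p + 1 + 1)
        = (s + 1) * ((s + 1) ^ (p + 1) - s ^ (p + 1)) + s ^ (p + 1) := by ring
      _ ≤ (s + 1) * ((p + 1) * (s + 1) ^ p) + (s + 1) ^ (p + 1) := add_le_add h2 h1
      _ = _ := by ring

/-- One step of the recursion `δ' ≤ min_t ((1 - t) δ + D t ^ (p + 1))`, measured by the potential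
`s ^ (p + 1) * δ`. -/
theorem succ_pow_mul_le_of_forall_le {p : ℕ} {s D δ δ' : ℝ} (hs : 0 ≤ s) (hD : 0 ≤ D)
    (hstep : ∀ t ∈ Set.Icc (0 : ℝ) 1, δ' ≤ (1 - t) * δ + D * t ^ (p + 1))
    (hδ : s ^ (p + 1) * δ ≤ s * (D * (p + 1) ^ (p + 1))) :
    (s + 1) ^ (p + 1) * δ' ≤ (s + 1) * (D * (p + 1) ^ (p + 1)) := by
  set B : ℝ := (s + 1) ^ (p + 1) with hB
  set w : ℝ := B - s ^ (p + 1) with hw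
  have hBpos : 0 < B := by positivity
  have hsB : s ^ (p + 1) ≤ B := by rw [hB]; gcongr; linarith
  have hw0 : 0 ≤ w := sub_nonneg.2 hsB
  have hwB : w ≤ B := by rw [hw]; linarith [pow_nonneg hs (p + 1)]
  have ht := hstep (w / B) ⟨by positivity, div_le_one_of_le₀ hwB hBpos.le⟩
  have hwpow : w ^ (p + 1) ≤ (p + 1) ^ (p + 1) * B ^ p := by
    calc w ^ (p + 1) ≤ ((p + 1) * (s + 1) ^ p) ^ (p + 1) :=
          pow_le_pow_left₀ hw0 (succ_pow_sub_pow_le p hs) _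
      _ = _ := by rw [hB, mul_pow, ← pow_mul, ← pow_mul, mul_comm p]
  have hquot : B * (D * (w / B) ^ (p + 1)) ≤ D * (p + 1) ^ (p + 1) := by
    calc B * (D * (w / B) ^ (p + 1)) = D * (w ^ (p + 1) / B ^ p) := by
          rw [div_pow, pow_succ B]; field_simp
      _ ≤ D * (p + 1) ^ (p + 1) := by
          refine mul_le_mul_of_nonneg_left ?_ hD
          rwa [div_le_iff₀ (by positivity)]
  have hlin : B * ((1 - w / B) * δ) = s ^ (p + 1) * δ := by
    rw [hw]; field_simp; ring
  calc B * δ' ≤ B * ((1 - w / B) * δ + D * (w / B) ^ (p + 1)) :=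
        mul_le_mul_of_nonneg_left ht hBpos.le
    _ = s ^ (p + 1) * δ + B * (D * (w / B) ^ (p + 1)) := by rw [mul_add, hlin]
    _ ≤ _ := by linarith

/-- If the regularization parameter `σ` is at least the observed one `η`, a minimizer `x + d` of the
regularized model plus `ψ` has a composite value bounded along the segment from `x` to `y`. -/
theorem composite_le_of_model_minimizer {n p : ℕ} {f ψ : EuclideanSpace ℝ (Fin n) → ℝ}
    {domψ : Set (EuclideanSpace ℝ (Fin n))} {L σ η C R : ℝ}
    {x d y : EuclideanSpace ℝ (Fin n)}
    (hrem : ∀ h, |f (x + h) - taylorPoly p f x (x + h)|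
      ≤ L / (Nat.factorial (p + 1) : ℝ) * ‖h‖ ^ (p + 1))
    (hfconv : ConvexOn ℝ Set.univ f) (hψconv : ConvexOn ℝ domψ ψ)
    (hx : x ∈ domψ) (hy : y ∈ domψ) (hd : d ≠ 0)
    (hmin : ∀ z ∈ domψ,
      omegaReg p σ f x (x + d) + ψ (x + d) ≤ omegaReg p σ f x z + ψ z)
    (hη : η / (Nat.factorial (p + 1) : ℝ)
      = (f (x + d) - taylorPoly p f x (x + d)) / ‖d‖ ^ (p + 1))
    (hησ : η ≤ σ) (hC : L + σ ≤ C) (hC0 : 0 ≤ C) (hR : ‖y - x‖ ≤ R)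
    {t : ℝ} (ht : t ∈ Set.Icc (0 : ℝ) 1) :
    f (x + d) + ψ (x + d)
      ≤ (1 - t) * (f x + ψ x) + t * (f y + ψ y)
        + C * R ^ (p + 1) / (Nat.factorial (p + 1) : ℝ) * t ^ (p + 1) := by
  have hfac : (0 : ℝ) < Nat.factorial (p + 1) := by positivity
  have hd0 : 0 < ‖d‖ ^ (p + 1) := pow_pos (norm_pos_iff.2 hd) _
  have ht1 : 0 ≤ 1 - t := sub_nonneg.2 ht.2
  have hz : x + t • (y - x) = (1 - t) • x + t • y := by module
  have hfz := hfconv.2 (Set.mem_univ x) (Set.mem_univ y) ht1 ht.1 (by ring)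
  have hψz := hψconv.2 hx hy ht1 ht.1 (by ring)
  have hzmem := hψconv.1 hx hy ht1 ht.1 (by ring)
  rw [← hz] at hfz hψz hzmem
  simp only [smul_eq_mul] at hfz hψz
  have hm := hmin _ hzmem
  have hr := (neg_abs_le _).trans' (neg_le_neg (hrem (t • (y - x))))
  simp only [omegaReg, add_sub_cancel_left] at hm
  have hfd : f (x + d) ≤ taylorPoly p f x (x + d)
      + σ / (Nat.factorial (p + 1) : ℝ) * ‖d‖ ^ (p + 1) := by
    rw [eq_div_iff hd0.ne'] at hη
    have : η / (Nat.factorial (p + 1) : ℝ) * ‖d‖ ^ (p + 1)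
        ≤ σ / (Nat.factorial (p + 1) : ℝ) * ‖d‖ ^ (p + 1) := by gcongr
    linarith
  have hnorm : ‖t • (y - x)‖ ≤ t * R := by
    rw [norm_smul, Real.norm_of_nonneg ht.1]
    exact mul_le_mul_of_nonneg_left hR ht.1
  have herr : (L + σ) / (Nat.factorial (p + 1) : ℝ) * ‖t • (y - x)‖ ^ (p + 1)
      ≤ C * R ^ (p + 1) / (Nat.factorial (p + 1) : ℝ) * t ^ (p + 1) := by
    calc _ ≤ C / (Nat.factorial (p + 1) : ℝ) * (t * R) ^ (p + 1) := by gcongr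
      _ = _ := by rw [mul_pow]; ring
  rw [add_div, add_mul] at herr
  linarith

theorem HAR_convex_rate
    {n : ℕ} (p : ℕ) (hp : 1 ≤ p)
    (f : EuclideanSpace ℝ (Fin n) → ℝ) (Lp : ℝ)
    (hf : ContDiff ℝ p f)
    (hLip : ∀ x y : EuclideanSpace ℝ (Fin n),
      ‖iteratedFDeriv ℝ p f x - iteratedFDeriv ℝ p f y‖ ≤ Lp * ‖x - y‖)
    (domψ : Set (EuclideanSpace ℝ (Fin n))) (ψ : EuclideanSpace ℝ (Fin n) → ℝ)
    (hdom_ne : domψ.Nonempty) (hdom_closed : IsClosed domψ) (hdom_conv : Convex ℝ domψ)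
    (hψconv : ConvexOn ℝ domψ ψ) (hψlsc : LowerSemicontinuousOn ψ domψ)
    (xstar : EuclideanSpace ℝ (Fin n)) (hstar : xstar ∈ domψ)
    (hminF : ∀ z ∈ domψ, f xstar + ψ xstar ≤ f z + ψ z)
    (α : ℝ) (hα : 1 < α)
    (x d : ℕ → EuclideanSpace ℝ (Fin n)) (H M : ℕ → ℝ)
    (hx0 : x 0 ∈ domψ) (hH0 : 0 < H 0) (hM0 : M 0 = H 0)
    (hM : ∀ k, 1 ≤ k → M k = max (M (k - 1)) (H (k - 1)))
    (hdmem : ∀ k, 1 ≤ k → x (k - 1) + d k ∈ domψ)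
    (hdmin : ∀ k, 1 ≤ k → ∀ z ∈ domψ,
      omegaReg p (α * M k) f (x (k - 1)) (x (k - 1) + d k) + ψ (x (k - 1) + d k)
        ≤ omegaReg p (α * M k) f (x (k - 1)) z + ψ z)
    (hdne : ∀ k, 1 ≤ k → d k ≠ 0)
    (hxk : ∀ k, 1 ≤ k →
      x k = if f (x (k - 1) + d k) + ψ (x (k - 1) + d k) ≤ f (x (k - 1)) + ψ (x (k - 1))
            then x (k - 1) + d k else x (k - 1))
    (hHk : ∀ k, 1 ≤ k → H k / (Nat.factorial (p + 1) : ℝ)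
      = (f (x (k - 1) + d k) - taylorPoly p f (x (k - 1)) (x (k - 1) + d k)) / ‖d k‖ ^ (p + 1))
    (hfconv : ConvexOn ℝ Set.univ f) (R : ℝ)
    (hR : ∀ z ∈ domψ, f z + ψ z ≤ f (x 0) + ψ (x 0) →
      ∀ w ∈ domψ, f w + ψ w ≤ f (x 0) + ψ (x 0) → ‖z - w‖ ≤ R) :
    ∀ k : ℕ, (Ubar α (H 0) Lp : ℝ) < (k : ℝ) →
      f (x k) + ψ (x k) - (f xstar + ψ xstar)
        ≤ (2 * α * Hmax (H 0) Lp * R ^ (p + 1) / (Nat.factorial p : ℝ))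
          * (((p : ℝ) + 1) / ((k : ℝ) - (Ubar α (H 0) Lp : ℝ))) ^ p := by
  intro k hk
  have hrem := abs_sub_taylorPoly_le hp hf hLip
  set Hm : ℝ := Hmax (H 0) Lp with hHm
  have hH0m : H 0 ≤ Hm := le_max_left _ _
  have hLm : Lp ≤ Hm := le_max_right _ _
  have hHm0 : 0 < Hm := hH0.trans_le hH0m
  have hHL : ∀ j, 1 ≤ j → H j ≤ Lp := by
    intro j hj
    have hd0 : 0 < ‖d j‖ ^ (p + 1) := pow_pos (norm_pos_iff.2 (hdne j hj)) _
    have h1 := (le_abs_self _).trans (hrem (x (j - 1)) (d j))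
    rw [← div_le_iff₀ hd0, ← hHk j hj] at h1
    exact (div_le_div_iff_of_pos_right (by positivity)).1 h1
  have hHHm : ∀ j, H j ≤ Hm := by
    intro j
    rcases Nat.eq_zero_or_pos j with rfl | hj
    · exact hH0m
    · exact (hHL j hj).trans hLm
  have hMsucc : ∀ j, M (j + 1) = max (M j) (H j) := fun j => hM (j + 1) (by omega)
  have hMHm : ∀ j, M j ≤ Hm := by
    intro j
    induction j with
    | zero => rw [hM0]; exact hH0m
    | succ j ih => rw [hMsucc]; exact max_le ih (hHHm j)
  have hMpos : ∀ j, 0 < M j := by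
    intro j
    induction j with
    | zero => rwa [hM0]
    | succ j ih => rw [hMsucc]; exact ih.trans_le (le_max_left _ _)
  have hdesc : ∀ j, x (j + 1) ∈ domψ ∨ x (j + 1) = x j := by
    intro j
    have h1 := hxk (j + 1) (by omega)
    have h2 := hdmem (j + 1) (by omega)
    simp only [Nat.add_sub_cancel] at h1 h2
    split_ifs at h1 with h
    · exact Or.inl (h1 ▸ h2)
    · exact Or.inr h1
  have hxmem : ∀ j, x j ∈ domψ := by
    intro j
    induction j with
    | zero => exact hx0
    | succ j ih => exact (hdesc j).elim id fun h => h ▸ ih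
  have hmono : ∀ j, f (x (j + 1)) + ψ (x (j + 1)) ≤ f (x j) + ψ (x j) ∧
      f (x (j + 1)) + ψ (x (j + 1)) ≤ f (x j + d (j + 1)) + ψ (x j + d (j + 1)) := by
    intro j
    have h1 := hxk (j + 1) (by omega)
    simp only [Nat.add_sub_cancel] at h1
    split_ifs at h1 with h
    · rw [h1]; exact ⟨h, le_rfl⟩
    · rw [h1]; exact ⟨le_rfl, (not_le.1 h).le⟩
  have hlevel : ∀ j, f (x j) + ψ (x j) ≤ f (x 0) + ψ (x 0) := by
    intro j
    induction j with
    | zero => exact le_rfl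
    | succ j ih => exact (hmono j).1.trans ih
  have hdist : ∀ j, ‖xstar - x j‖ ≤ R := fun j =>
    hR _ hstar (hminF _ hx0) _ (hxmem j) (hlevel j)
  have hR0 : 0 ≤ R := (norm_nonneg _).trans (hdist 0)
  set D : ℝ := 2 * α * Hm * R ^ (p + 1) / (Nat.factorial (p + 1) : ℝ) with hD
  have hD0 : 0 ≤ D := by positivity
  have hstep : ∀ j, 2 * H (j + 1) ≤ (α + 1) * M (j + 1) → ∀ t ∈ Set.Icc (0 : ℝ) 1,
      f (x (j + 1)) + ψ (x (j + 1)) - (f xstar + ψ xstar)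
        ≤ (1 - t) * (f (x j) + ψ (x j) - (f xstar + ψ xstar)) + D * t ^ (p + 1) := by
    intro j hj t ht
    have hdm := hdmin (j + 1) (by omega)
    have hηk := hHk (j + 1) (by omega)
    simp only [Nat.add_sub_cancel] at hdm hηk
    have h1 := composite_le_of_model_minimizer (hrem (x j)) hfconv hψconv (hxmem j) hstar
      (hdne (j + 1) (by omega)) hdm hηk (C := 2 * α * Hm)
      (by nlinarith [hMpos (j + 1)]) (by nlinarith [hMHm (j + 1)]) (by positivity) (hdist j) ht
    linarith [(hmono j).2]
  have hinv : ∀ j, ∃ s u : ℕ, s + u = j ∧ ((α + 1) / 2) ^ u * H 0 ≤ M (j + 1) ∧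
      (s : ℝ) ^ (p + 1) * (f (x j) + ψ (x j) - (f xstar + ψ xstar))
        ≤ s * (D * (p + 1) ^ (p + 1)) := by
    intro j
    induction j with
    | zero => exact ⟨0, 0, rfl, by rw [hMsucc]; simp, by simp⟩
    | succ j ih =>
      obtain ⟨s, u, hsu, hu, hs⟩ := ih
      by_cases hj : 2 * H (j + 1) ≤ (α + 1) * M (j + 1)
      · refine ⟨s + 1, u, by omega, ?_, ?_⟩
        · rw [hMsucc]; exact hu.trans (le_max_left _ _)
        · push_cast
          exact succ_pow_mul_le_of_forall_le (Nat.cast_nonneg s) hD0 (hstep j hj) hs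
      · refine ⟨s, u + 1, by omega, ?_, ?_⟩
        · rw [hMsucc, pow_succ]
          refine le_trans ?_ (le_max_right _ _)
          have := mul_le_mul_of_nonneg_left hu (by linarith : 0 ≤ (α + 1) / 2)
          linarith
        · exact (mul_le_mul_of_nonneg_left (by linarith [(hmono j).1]) (by positivity)).trans hs
  obtain ⟨s, u, hsu, hu, hs⟩ := hinv k
  have hub : (u : ℝ) ≤ (Ubar α (H 0) Lp : ℝ) := by
    have h1 : ((α + 1) / 2) ^ u ≤ Hm / H 0 := by
      rw [le_div_iff₀ hH0]; exact hu.trans (hMHm _)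
    refine le_trans ?_ (Int.le_ceil _)
    rw [Real.le_logb_iff_rpow_le (by linarith) (by positivity), Real.rpow_natCast]
    exact h1
  have hKs : (k : ℝ) - (Ubar α (H 0) Lp : ℝ) ≤ s := by
    rw [← hsu]; push_cast; linarith
  have hK0 : 0 < (k : ℝ) - (Ubar α (H 0) Lp : ℝ) := sub_pos.2 hk
  have hs0 : (0 : ℝ) < s := hK0.trans_le hKs
  calc f (x k) + ψ (x k) - (f xstar + ψ xstar)
      ≤ D * (p + 1) * ((p + 1) / s) ^ p := by
        rw [← mul_le_mul_iff_right₀ (pow_pos hs0 (p + 1))]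
        refine hs.trans_eq ?_
        rw [div_pow]
        field_simp
        ring
    _ ≤ D * (p + 1) * ((p + 1) / ((k : ℝ) - (Ubar α (H 0) Lp : ℝ))) ^ p := by gcongr
    _ = _ := by
        rw [hD, Nat.factorial_succ]
        push_cast
        field_simp
end
end

section
/- Consider the HAR method run on F = f + ψ. For every successful iteration k ∈ S (so that x^k = x^{k−1} + d^k), there exists a subgradient u of ψ at x^k such that ‖∇f(x^k) + u‖ ≤ (2 α H_max / p!) · ‖d^k‖^p; in particular dist(0, ∂F(x^k)) ≤ (2 α H_max / p!) · ‖d^k‖^p, where H_max = max{H_0, L_p}. -/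
open scoped BigOperators RealInnerProductSpace

noncomputable section

section TaylorEstimates

universe u

variable {E F : Type u} [NormedAddCommGroup E] [NormedSpace ℝ E] [NormedAddCommGroup F]
  [NormedSpace ℝ F]

/-- The Taylor polynomial of order `p` at `x` of a vector-valued map, evaluated at `y`. -/
def taylorSum (p : ℕ) (f : E → F) (x y : E) : F :=
  ∑ ℓ ∈ Finset.range (p + 1),
    (1 / (Nat.factorial ℓ : ℝ)) • iteratedFDeriv ℝ ℓ f x (fun _ => y - x)

theorem taylorSum_zero (f : E → F) (x y : E) : taylorSum 0 f x y = f x := by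
  simp [taylorSum]

theorem taylorSum_self (p : ℕ) (f : E → F) (x : E) : taylorSum p f x x = f x := by
  rw [taylorSum, Finset.sum_range_succ', Finset.sum_eq_zero]
  · simp
  · intro i _
    rw [(iteratedFDeriv ℝ (i + 1) f x).map_coord_zero 0 (sub_self x), smul_zero]

theorem apply_iteratedFDeriv_of_comp_eq {g : E → F} (e : F ≃L[ℝ] F) (he : e ∘ g = g) {ℓ : ℕ}
    (x : E) (m : Fin ℓ → E) : e (iteratedFDeriv ℝ ℓ g x m) = iteratedFDeriv ℝ ℓ g x m := by
  have hcomp := e.iteratedFDeriv_comp_left (f := g) (x := x) (i := ℓ)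
  rw [he] at hcomp
  exact (DFunLike.congr_fun hcomp m).symm

/-- When all arguments of an iterated derivative except one coincide, the position of the
exceptional one does not matter. -/
theorem iteratedFDeriv_succ_update_const (x h v : E) (ℓ : ℕ) :
    ∀ {F : Type u} [NormedAddCommGroup F] [NormedSpace ℝ F] {f : E → F},
      ContDiff ℝ (ℓ + 1 : ℕ) f → ∀ i : Fin (ℓ + 1),
      iteratedFDeriv ℝ (ℓ + 1) f x (Function.update (fun _ => h) i v)
        = iteratedFDeriv ℝ ℓ (fderiv ℝ f) x (fun _ => h) v := by
  induction ℓ with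
  | zero =>
    intro F _ _ f _ i
    rw [Fin.fin_one_eq_zero i]
    simp
  | succ ℓ ih =>
    intro F _ _ f hf i
    have hfd : ContDiff ℝ (ℓ + 1 : ℕ) (fderiv ℝ f) := hf.fderiv_right (by norm_cast)
    rw [iteratedFDeriv_succ_apply_right]
    cases i using Fin.lastCases with
    | last =>
      have hinit : Fin.init (Function.update (fun _ => h) (Fin.last (ℓ + 1)) v)
          = fun _ : Fin (ℓ + 1) => h := by
        ext j
        simp [Fin.init]
      rw [hinit, Function.update_self]
    | cast j =>
      rw [Fin.init_update_castSucc, Function.update_of_ne j.castSucc_lt_last.ne']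
      change iteratedFDeriv ℝ (ℓ + 1) (fderiv ℝ f) x (Function.update (fun _ => h) j v) h = _
      rw [ih hfd j, iteratedFDeriv_succ_apply_right]
      obtain ⟨e, he⟩ : ∃ e : (E →L[ℝ] E →L[ℝ] F) ≃L[ℝ] (E →L[ℝ] E →L[ℝ] F),
          ∀ A a b, e A a b = A b a :=
        ⟨(ContinuousLinearMap.flipₗᵢ ℝ E E F).toContinuousLinearEquiv, fun _ _ _ => rfl⟩
      have hflip : e ∘ fderiv ℝ (fderiv ℝ f) = fderiv ℝ (fderiv ℝ f) := by
        funext z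
        ext a b
        have hsymm : IsSymmSndFDerivAt ℝ f z := hf.contDiffAt.isSymmSndFDerivAt (by
          simp only [minSmoothness_of_isRCLikeNormedField]
          norm_cast
          omega)
        rw [Function.comp_apply, he]
        exact hsymm b a
      have happ := apply_iteratedFDeriv_of_comp_eq (F := E →L[ℝ] E →L[ℝ] F) e hflip x
        (fun _ : Fin ℓ => h)
      rw [← he, happ]
      rfl

theorem hasFDerivAt_iteratedFDeriv_diag {ℓ : ℕ} {f : E → F} (hf : ContDiff ℝ (ℓ + 1 : ℕ) f)
    (x y : E) :
    HasFDerivAt (fun y => iteratedFDeriv ℝ (ℓ + 1) f x (fun _ => y - x))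
      ((ℓ + 1 : ℝ) • iteratedFDeriv ℝ ℓ (fderiv ℝ f) x (fun _ => y - x)) y := by
  have hdiag : HasFDerivAt (fun y : E => fun _ : Fin (ℓ + 1) => y - x)
      (ContinuousLinearMap.pi fun _ => ContinuousLinearMap.id ℝ E) y :=
    hasFDerivAt_pi.2 fun _ => (hasFDerivAt_id y).sub_const x
  refine (((iteratedFDeriv ℝ (ℓ + 1) f x).hasFDerivAt _).comp y hdiag).congr_fderiv ?_
  ext v
  simp [ContinuousMultilinearMap.linearDeriv_apply, iteratedFDeriv_succ_update_const x _ _ ℓ hf,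
    ← Nat.cast_smul_eq_nsmul ℝ]

theorem hasFDerivAt_taylorSum {p : ℕ} {f : E → F} (hf : ContDiff ℝ (p + 1 : ℕ) f) (x y : E) :
    HasFDerivAt (taylorSum (p + 1) f x) (taylorSum p (fderiv ℝ f) x y) y := by
  have hterm : ∀ ℓ ∈ Finset.range (p + 1), HasFDerivAt
      (fun y => (1 / ((ℓ + 1).factorial : ℝ)) • iteratedFDeriv ℝ (ℓ + 1) f x (fun _ => y - x))
      ((1 / (ℓ.factorial : ℝ)) • iteratedFDeriv ℝ ℓ (fderiv ℝ f) x (fun _ => y - x)) y := by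
    intro ℓ hℓ
    have hℓp : ((ℓ + 1 : ℕ) : WithTop ℕ∞) ≤ (p + 1 : ℕ) := by
      exact_mod_cast Finset.mem_range.1 hℓ
    refine ((hasFDerivAt_iteratedFDeriv_diag (hf.of_le hℓp) x y).const_smul
      (1 / ((ℓ + 1).factorial : ℝ))).congr_fderiv ?_
    rw [smul_smul, Nat.factorial_succ]
    congr 1
    push_cast
    have : (ℓ.factorial : ℝ) ≠ 0 := by positivity
    field_simp
  have hsum := (HasFDerivAt.fun_sum hterm).add_const (f x)
  refine hsum.congr_of_eventuallyEq (Filter.Eventually.of_forall fun z => ?_)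
  rw [taylorSum, Finset.sum_range_succ']
  simp

theorem norm_le_of_norm_fderiv_le_pow {R : E → F} {R' : E → E →L[ℝ] F} {C : ℝ} {p : ℕ} {x : E}
    (hR : ∀ y, HasFDerivAt R (R' y) y) (hx : R x = 0)
    (hbound : ∀ y, ‖R' y‖ ≤ C * ‖y - x‖ ^ p) (y : E) :
    ‖R y‖ ≤ C / (p + 1) * ‖y - x‖ ^ (p + 1) := by
  have hline : ∀ t : ℝ, HasDerivAt (fun t : ℝ => x + t • (y - x)) (y - x) t := fun t => by
    simpa using ((hasDerivAt_id t).smul_const (y - x)).const_add x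
  have hRline : ∀ t : ℝ, HasDerivAt (fun t : ℝ => R (x + t • (y - x)))
      (R' (x + t • (y - x)) (y - x)) t := fun t => (hR _).comp_hasDerivAt t (hline t)
  have hB : ∀ t : ℝ, HasDerivAt
      (fun t : ℝ => C / (p + 1) * ‖y - x‖ ^ (p + 1) * t ^ (p + 1))
      (C * ‖y - x‖ ^ (p + 1) * t ^ p) t := fun t => by
    refine ((hasDerivAt_pow (p + 1) t).const_mul _).congr_deriv ?_
    have : (p + 1 : ℝ) ≠ 0 := by positivity
    simp only [Nat.add_sub_cancel, Nat.cast_add, Nat.cast_one]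
    field_simp
  have key := image_norm_le_of_norm_deriv_right_le_deriv_boundary (a := 0) (b := 1)
    (fun t _ => (hRline t).continuousAt.continuousWithinAt)
    (fun t _ => (hRline t).hasDerivWithinAt) (by simp [hx]) hB
    (fun t ht => by
      calc ‖R' (x + t • (y - x)) (y - x)‖
          ≤ ‖R' (x + t • (y - x))‖ * ‖y - x‖ := ContinuousLinearMap.le_opNorm _ _
        _ ≤ C * ‖x + t • (y - x) - x‖ ^ p * ‖y - x‖ := by gcongr; exact hbound _
        _ = C * ‖y - x‖ ^ (p + 1) * t ^ p := by
          rw [add_sub_cancel_left, norm_smul, Real.norm_of_nonneg ht.1]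
          ring)
    (Set.right_mem_Icc.2 zero_le_one)
  simpa using key

theorem norm_iteratedFDeriv_fderiv_sub {p : ℕ} (f : E → F) (x y : E) :
    ‖iteratedFDeriv ℝ p (fderiv ℝ f) x - iteratedFDeriv ℝ p (fderiv ℝ f) y‖
      = ‖iteratedFDeriv ℝ (p + 1) f x - iteratedFDeriv ℝ (p + 1) f y‖ := by
  rw [iteratedFDeriv_succ_eq_comp_right, iteratedFDeriv_succ_eq_comp_right]
  exact (LinearIsometryEquiv.norm_map (continuousMultilinearCurryRightEquiv' ℝ p E F).symm
    (iteratedFDeriv ℝ p (fderiv ℝ f) x - iteratedFDeriv ℝ p (fderiv ℝ f) y)).symm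

/-- Taylor's theorem with Lipschitz `p`-th derivative. -/
theorem norm_sub_taylorSum_le {L : ℝ} (x : E) (p : ℕ) :
    ∀ {F : Type u} [NormedAddCommGroup F] [NormedSpace ℝ F] {f : E → F}, ContDiff ℝ p f →
      (∀ x y, ‖iteratedFDeriv ℝ p f x - iteratedFDeriv ℝ p f y‖ ≤ L * ‖x - y‖) → ∀ y,
      ‖f y - taylorSum p f x y‖ ≤ L / ((p + 1).factorial : ℝ) * ‖y - x‖ ^ (p + 1) := by
  induction p with
  | zero =>
    intro F _ _ f _ hL y
    have h := hL y x
    rw [iteratedFDeriv_zero_eq_comp, Function.comp_apply, Function.comp_apply, ← map_sub,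
      LinearIsometryEquiv.norm_map] at h
    simpa [taylorSum_zero] using h
  | succ p ih =>
    intro F _ _ f hf hL y
    have hfd : ContDiff ℝ p (fderiv ℝ f) := hf.fderiv_right (by norm_cast)
    have hdiff : Differentiable ℝ f := hf.differentiable (by simp)
    have key := norm_le_of_norm_fderiv_le_pow (R := fun y => f y - taylorSum (p + 1) f x y)
      (fun z => (hdiff z).hasFDerivAt.sub (hasFDerivAt_taylorSum hf x z))
      (by simp [taylorSum_self])
      (ih hfd fun a b => (norm_iteratedFDeriv_fderiv_sub f a b).trans_le (hL a b)) y
    refine key.trans_eq ?_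
    rw [Nat.factorial_succ (p + 1)]
    push_cast
    rw [div_div, mul_comm ((p : ℝ) + 1 + 1)]

end TaylorEstimates

/-- First-order optimality for the sum of a differentiable and a convex function: the negative
derivative of the smooth part is a subgradient of the convex part. -/
theorem subgradient_of_isMinOn_add {E : Type*} [NormedAddCommGroup E] [NormedSpace ℝ E]
    {s : Set E} {φ ψ : E → ℝ} {φ' : E →L[ℝ] ℝ} {y : E} (hψ : ConvexOn ℝ s ψ) (hy : y ∈ s)
    (hφ : HasFDerivAt φ φ' y) (hmin : ∀ z ∈ s, φ y + ψ y ≤ φ z + ψ z) {z : E} (hz : z ∈ s) :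
    ψ y - φ' (z - y) ≤ ψ z := by
  have hline : HasDerivAt (fun t : ℝ => y + t • (z - y)) (z - y) 0 := by
    simpa using ((hasDerivAt_id (0 : ℝ)).smul_const (z - y)).const_add y
  have hφ0 : HasFDerivAt φ φ' (y + (0 : ℝ) • (z - y)) := by simpa using hφ
  have hderiv := (hφ0.comp_hasDerivAt (0 : ℝ) hline).hasDerivWithinAt (s := Set.Ioi 0)
  rw [hasDerivWithinAt_iff_tendsto_slope' (by simp)] at hderiv
  have hle : ψ y - ψ z ≤ φ' (z - y) := by
    refine ge_of_tendsto hderiv ?_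
    filter_upwards [Ioo_mem_nhdsGT (zero_lt_one' ℝ)] with t ht
    have hcomb : y + t • (z - y) = (1 - t) • y + t • z := by module
    have hconv := hψ.2 hy hz (sub_nonneg.2 ht.2.le) ht.1.le (by ring)
    have hmem := hψ.1 hy hz (sub_nonneg.2 ht.2.le) ht.1.le (by ring)
    rw [← hcomb] at hconv hmem
    have hm := hmin _ hmem
    simp only [smul_eq_mul] at hconv
    simp only [slope_def_field, Function.comp_apply, zero_smul, add_zero, sub_zero]
    rw [le_div_iff₀ ht.1]
    linarith
  linarith

theorem taylorPoly_eq_taylorSum {n : ℕ} (p : ℕ) (f : EuclideanSpace ℝ (Fin n) → ℝ)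
    (x y : EuclideanSpace ℝ (Fin n)) : taylorPoly p f x y = taylorSum p f x y := by
  rw [taylorPoly, taylorSum, Finset.sum_range_succ', Finset.range_eq_Ico, add_comm,
    Finset.sum_Ico_add' (fun ℓ => (1 / (Nat.factorial ℓ : ℝ)) •
      iteratedFDeriv ℝ ℓ f x (fun _ => y - x)) 0 p 1]
  simp [Finset.Ico_add_one_right_eq_Icc]

theorem omegaReg_self {n : ℕ} (p : ℕ) (σ : ℝ) (f : EuclideanSpace ℝ (Fin n) → ℝ)
    (x : EuclideanSpace ℝ (Fin n)) : omegaReg p σ f x x = f x := by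
  simp [omegaReg, taylorPoly_eq_taylorSum, taylorSum_self]

/-- The derivative of `‖· - x‖ ^ (p + 1)`, with the bound on its norm. -/
theorem exists_hasFDerivAt_norm_sub_pow {E : Type*} [NormedAddCommGroup E]
    [InnerProductSpace ℝ E] {p : ℕ} (hp : 1 ≤ p) (x y : E) :
    ∃ N : E →L[ℝ] ℝ, HasFDerivAt (fun z => ‖z - x‖ ^ (p + 1)) N y ∧
      ‖N‖ ≤ (p + 1) * ‖y - x‖ ^ p := by
  have hp1 : (1 : ℝ) < ((p + 1 : ℕ) : ℝ) := by exact_mod_cast Nat.lt_succ_of_le hp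
  have h := (hasFDerivAt_norm_rpow (y - x) hp1).comp y ((hasFDerivAt_id y).sub_const x)
  simp only [Real.rpow_natCast, Function.comp_def] at h
  refine ⟨_, h, ?_⟩
  rw [ContinuousLinearMap.comp_id, norm_smul, innerSL_apply_norm]
  rcases eq_or_ne (y - x) 0 with h0 | h0
  · simp only [h0, norm_zero, mul_zero]
    positivity
  · have hpos : 0 < ‖y - x‖ := norm_pos_iff.2 h0
    rw [Real.norm_of_nonneg (by positivity), mul_assoc, ← Real.rpow_add_one hpos.ne']
    push_cast
    rw [show (p + 1 - 2 + 1 : ℝ) = (p : ℝ) by ring, Real.rpow_natCast]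

theorem HAR_successful_first_order
    {n : ℕ} (p : ℕ) (hp : 1 ≤ p)
    (f : EuclideanSpace ℝ (Fin n) → ℝ) (Lp : ℝ)
    (hf : ContDiff ℝ p f)
    (hLip : ∀ x y : EuclideanSpace ℝ (Fin n),
      ‖iteratedFDeriv ℝ p f x - iteratedFDeriv ℝ p f y‖ ≤ Lp * ‖x - y‖)
    (domψ : Set (EuclideanSpace ℝ (Fin n))) (ψ : EuclideanSpace ℝ (Fin n) → ℝ)
    (hdom_ne : domψ.Nonempty) (hdom_closed : IsClosed domψ) (hdom_conv : Convex ℝ domψ)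
    (hψconv : ConvexOn ℝ domψ ψ) (hψlsc : LowerSemicontinuousOn ψ domψ)
    (xstar : EuclideanSpace ℝ (Fin n)) (hstar : xstar ∈ domψ)
    (hminF : ∀ z ∈ domψ, f xstar + ψ xstar ≤ f z + ψ z)
    (α : ℝ) (hα : 1 < α)
    (x d : ℕ → EuclideanSpace ℝ (Fin n)) (H M : ℕ → ℝ)
    (hx0 : x 0 ∈ domψ) (hH0 : 0 < H 0) (hM0 : M 0 = H 0)
    (hM : ∀ k, 1 ≤ k → M k = max (M (k - 1)) (H (k - 1)))
    (hdmem : ∀ k, 1 ≤ k → x (k - 1) + d k ∈ domψ)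
    (hdmin : ∀ k, 1 ≤ k → ∀ z ∈ domψ,
      omegaReg p (α * M k) f (x (k - 1)) (x (k - 1) + d k) + ψ (x (k - 1) + d k)
        ≤ omegaReg p (α * M k) f (x (k - 1)) z + ψ z)
    (hdne : ∀ k, 1 ≤ k → d k ≠ 0)
    (hxk : ∀ k, 1 ≤ k →
      x k = if f (x (k - 1) + d k) + ψ (x (k - 1) + d k) ≤ f (x (k - 1)) + ψ (x (k - 1))
            then x (k - 1) + d k else x (k - 1))
    (hHk : ∀ k, 1 ≤ k → H k / (Nat.factorial (p + 1) : ℝ)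
      = (f (x (k - 1) + d k) - taylorPoly p f (x (k - 1)) (x (k - 1) + d k)) / ‖d k‖ ^ (p + 1)) :
    ∀ k : ℕ, 1 ≤ k → 2 * H k ≤ (α + 1) * M k →
      x k = x (k - 1) + d k ∧
      ∃ u : EuclideanSpace ℝ (Fin n),
        (∀ z ∈ domψ, ψ (x k) + ⟪u, z - x k⟫ ≤ ψ z) ∧
        ‖gradient f (x k) + u‖
          ≤ (2 * α * Hmax (H 0) Lp / (Nat.factorial p : ℝ)) * ‖d k‖ ^ p := by
  have hne1 := hdne 1 le_rfl
  have hLp : 0 ≤ Lp := by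
    have h := (norm_nonneg _).trans (hLip (d 1) 0)
    rw [sub_zero] at h
    exact nonneg_of_mul_nonneg_left h (norm_pos_iff.2 hne1)
  have hxmem : ∀ k, x k ∈ domψ := by
    intro k
    induction k with
    | zero => exact hx0
    | succ k ih =>
      rw [hxk (k + 1) (by omega)]
      split_ifs
      · exact hdmem (k + 1) (by omega)
      · exact ih
  have hHle : ∀ k, H k ≤ Hmax (H 0) Lp := by
    rintro (_ | k)
    · exact le_max_left _ _
    · refine le_trans ?_ (le_max_right _ _)
      have hpos : 0 < ‖d (k + 1)‖ ^ (p + 1) :=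
        pow_pos (norm_pos_iff.2 (hdne (k + 1) (by omega))) _
      have hT := norm_sub_taylorSum_le (x k) p hf hLip (x k + d (k + 1))
      rw [add_sub_cancel_left, ← taylorPoly_eq_taylorSum] at hT
      have h := hHk (k + 1) (by omega)
      rw [Nat.add_sub_cancel] at h
      have hle : H (k + 1) / ((p + 1).factorial : ℝ) ≤ Lp / ((p + 1).factorial : ℝ) := by
        rw [h, div_le_iff₀ hpos]
        exact (Real.le_norm_self _).trans hT
      rwa [div_le_div_iff_of_pos_right (by positivity)] at hle
  have hMle : ∀ k, M k ≤ Hmax (H 0) Lp := by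
    intro k
    induction k with
    | zero => exact hM0.trans_le (hHle 0)
    | succ k ih =>
      rw [hM (k + 1) (by omega)]
      exact max_le ih (hHle k)
  have hMpos : ∀ k, 0 < M k := by
    intro k
    induction k with
    | zero => rwa [hM0]
    | succ k ih =>
      rw [hM (k + 1) (by omega)]
      exact lt_max_of_lt_left ih
  intro k hk hsucc
  have hMk := hMpos k
  have hx : x k = x (k - 1) + d k := by
    rw [hxk k hk, if_pos]
    have hmin := hdmin k hk (x (k - 1)) (hxmem _)
    rw [omegaReg_self, omegaReg, add_sub_cancel_left] at hmin
    have hpos : 0 < ‖d k‖ ^ (p + 1) := pow_pos (norm_pos_iff.2 (hdne k hk)) _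
    have h := hHk k hk
    rw [eq_div_iff hpos.ne'] at h
    have hHσ : H k ≤ α * M k := by nlinarith
    have hmul : H k / ((p + 1).factorial : ℝ) * ‖d k‖ ^ (p + 1)
        ≤ α * M k / ((p + 1).factorial : ℝ) * ‖d k‖ ^ (p + 1) := by gcongr
    linarith
  refine ⟨hx, ?_⟩
  obtain ⟨q, rfl⟩ : ∃ q, p = q + 1 := ⟨p - 1, by omega⟩
  obtain ⟨N, hN, hNnorm⟩ := exists_hasFDerivAt_norm_sub_pow hp (x (k - 1)) (x k)
  have hxsub : x k - x (k - 1) = d k := by rw [hx, add_sub_cancel_left]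
  have hΩ : HasFDerivAt (omegaReg (q + 1) (α * M k) f (x (k - 1)))
      (taylorSum q (fderiv ℝ f) (x (k - 1)) (x k)
        + (α * M k / ((q + 1 + 1).factorial : ℝ)) • N) (x k) := by
    refine ((hasFDerivAt_taylorSum hf (x (k - 1)) (x k)).add
      (hN.const_mul _)).congr_of_eventuallyEq (Filter.Eventually.of_forall fun z => ?_)
    simp [omegaReg, taylorPoly_eq_taylorSum]
  set Ω' := taylorSum q (fderiv ℝ f) (x (k - 1)) (x k)
    + (α * M k / ((q + 1 + 1).factorial : ℝ)) • N with hΩ'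
  refine ⟨-(InnerProductSpace.toDual ℝ _).symm Ω', fun z hz => ?_, ?_⟩
  · have h := subgradient_of_isMinOn_add hψconv (hxmem k) hΩ (hx ▸ hdmin k hk) hz
    rwa [inner_neg_left, InnerProductSpace.toDual_symm_apply, ← sub_eq_add_neg]
  · rw [gradient, ← sub_eq_add_neg, ← map_sub, LinearIsometryEquiv.norm_map, hΩ', ← sub_sub]
    have hfd : ContDiff ℝ q (fderiv ℝ f) := hf.fderiv_right (by norm_cast)
    have hT := norm_sub_taylorSum_le (x (k - 1)) q hfd
      (fun a b => (norm_iteratedFDeriv_fderiv_sub f a b).trans_le (hLip a b)) (x k)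
    rw [hxsub] at hT hNnorm
    have hreg : ‖(α * M k / ((q + 1 + 1).factorial : ℝ)) • N‖
        ≤ α * M k / ((q + 1).factorial : ℝ) * ‖d k‖ ^ (q + 1) := by
      rw [norm_smul, Real.norm_of_nonneg (by positivity)]
      calc α * M k / ((q + 1 + 1).factorial : ℝ) * ‖N‖
          ≤ α * M k / ((q + 1 + 1).factorial : ℝ)
            * (((q + 1 : ℕ) + 1) * ‖d k‖ ^ (q + 1)) := by gcongr
        _ = α * M k / ((q + 1).factorial : ℝ) * ‖d k‖ ^ (q + 1) := by
          rw [Nat.factorial_succ (q + 1)]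
          push_cast
          field_simp
    have hcoef : Lp + α * M k ≤ 2 * α * Hmax (H 0) Lp := by
      have h1 : Lp ≤ Hmax (H 0) Lp := le_max_right _ _
      have h2 := hMle k
      nlinarith
    calc _ ≤ Lp / ((q + 1).factorial : ℝ) * ‖d k‖ ^ (q + 1)
          + α * M k / ((q + 1).factorial : ℝ) * ‖d k‖ ^ (q + 1) :=
          (norm_sub_le _ _).trans (add_le_add hT hreg)
      _ = (Lp + α * M k) / ((q + 1).factorial : ℝ) * ‖d k‖ ^ (q + 1) := by ring
      _ ≤ _ := by gcongr
end
end
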